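/- arXiv:1801.01838 — 2 statements merged into one kernel-verified Lean document; each statement's English description precedes it below -/
import Mathlib

section
/- Under the standing assumptions, 𝒜 is invertible and for every nonzero w ∈ ℝ^{Q·Nu} one has (ν̲₀ − √3·σ·χ) · w^T 𝒜^{-1} w ≤ w^T (I_Q ⊗ A)^{-1} w ≤ (ν̄₀ + √3·σ·χ) · w^T 𝒜^{-1} w. (Transfer of the spectral bounds between 𝒜 and the mean-based matrix I_Q ⊗ A to their inverses.) -/
open Matrix
open scoped Kronecker BigOperators

lemma psd_of_quad {n : Type*} [Fintype n] (X : Matrix n n ℝ) (hs : X.IsSymm)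
    (h : ∀ v : n → ℝ, 0 ≤ v ⬝ᵥ X *ᵥ v) : X.PosSemidef := by
  refine Matrix.PosSemidef.of_dotProduct_mulVec_nonneg ?_ (fun v => by simpa using h v)
  simpa [Matrix.IsHermitian, Matrix.conjTranspose_eq_transpose_of_trivial] using hs.eq

lemma quad_of_psd {n : Type*} [Fintype n] (X : Matrix n n ℝ) (h : X.PosSemidef) (v : n → ℝ) :
    0 ≤ v ⬝ᵥ X *ᵥ v := by
  simpa using h.dotProduct_mulVec_nonneg v

lemma kron_bound {q n : Type*} [Fintype q] [DecidableEq q] [Fintype n]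
    (G : Matrix q q ℝ) (A B : Matrix n n ℝ) (s c : ℝ)
    (hG : G.IsSymm) (hA : A.IsSymm) (hB : B.IsSymm)
    (hGb : ∀ a : q → ℝ, |a ⬝ᵥ G *ᵥ a| ≤ s * (a ⬝ᵥ a))
    (hBb : ∀ v : n → ℝ, |v ⬝ᵥ B *ᵥ v| ≤ c * (v ⬝ᵥ A *ᵥ v)) (x : q × n → ℝ) :
    |x ⬝ᵥ (G ⊗ₖ B) *ᵥ x| ≤ s * c * (x ⬝ᵥ ((1 : Matrix q q ℝ) ⊗ₖ A) *ᵥ x) := by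
  have h1 : (s • (1 : Matrix q q ℝ) + G).PosSemidef := by
    refine psd_of_quad _ ((isSymm_one.smul s).add hG) fun v => ?_
    have := (abs_le.1 (hGb v)).1
    simp only [add_mulVec, smul_mulVec, one_mulVec, dotProduct_add, dotProduct_smul, smul_eq_mul]
    linarith
  have h2 : (s • (1 : Matrix q q ℝ) - G).PosSemidef := by
    refine psd_of_quad _ ((isSymm_one.smul s).sub hG) fun v => ?_
    have := (abs_le.1 (hGb v)).2
    simp only [sub_mulVec, smul_mulVec, one_mulVec, dotProduct_sub, dotProduct_smul, smul_eq_mul]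
    linarith
  have h3 : (c • A + B).PosSemidef := by
    refine psd_of_quad _ ((hA.smul c).add hB) fun v => ?_
    have := (abs_le.1 (hBb v)).1
    simp only [add_mulVec, smul_mulVec, dotProduct_add, dotProduct_smul, smul_eq_mul]
    linarith
  have h4 : (c • A - B).PosSemidef := by
    refine psd_of_quad _ ((hA.smul c).sub hB) fun v => ?_
    have := (abs_le.1 (hBb v)).2
    simp only [sub_mulVec, smul_mulVec, dotProduct_sub, dotProduct_smul, smul_eq_mul]
    linarith
  have e1 := quad_of_psd _ (h1.kronecker h3) x
  have e2 := quad_of_psd _ (h2.kronecker h4) x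
  have e3 := quad_of_psd _ (h1.kronecker h4) x
  have e4 := quad_of_psd _ (h2.kronecker h3) x
  simp only [sub_eq_add_neg, ← neg_one_smul ℝ G, ← neg_one_smul ℝ B, add_kronecker, kronecker_add,
    smul_kronecker, kronecker_smul, add_mulVec, smul_mulVec, dotProduct_add, dotProduct_smul,
    smul_eq_mul] at e1 e2 e3 e4
  rw [abs_le]
  constructor <;> linarith

lemma inv_bound {n : Type*} [Fintype n] [DecidableEq n] (P R : Matrix n n ℝ)
    (hP : IsUnit P) (hR : R.PosDef) (c : ℝ) (hc : 0 < c)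
    (h : ∀ x : n → ℝ, x ⬝ᵥ R *ᵥ x ≤ c * (x ⬝ᵥ P *ᵥ x)) (w : n → ℝ) :
    w ⬝ᵥ P⁻¹ *ᵥ w ≤ c * (w ⬝ᵥ R⁻¹ *ᵥ w) := by
  obtain ⟨x, hx⟩ : ∃ x, x = P⁻¹ *ᵥ w := ⟨_, rfl⟩
  obtain ⟨y, hy⟩ : ∃ y, y = R⁻¹ *ᵥ w := ⟨_, rfl⟩
  have hPx : P *ᵥ x = w := by
    rw [hx, mulVec_mulVec, mul_nonsing_inv _ ((isUnit_iff_isUnit_det _).1 hP), one_mulVec]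
  have hRy : R *ᵥ y = w := by
    rw [hy, mulVec_mulVec, mul_nonsing_inv _ ((isUnit_iff_isUnit_det _).1 hR.isUnit), one_mulVec]
  rw [← hx, ← hy]
  have hs : Rᵀ = R := by
    simpa [Matrix.IsHermitian, Matrix.conjTranspose_eq_transpose_of_trivial] using hR.isHermitian
  have h0 := quad_of_psd _ hR.posSemidef (x - c • y)
  have h1 := h x
  have h2 : y ⬝ᵥ R *ᵥ x = w ⬝ᵥ x := by
    rw [dotProduct_mulVec, ← mulVec_transpose, hs, hRy]
  rw [hPx, dotProduct_comm x w] at h1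
  simp only [mulVec_sub, mulVec_smul, dotProduct_sub, sub_dotProduct, smul_dotProduct,
    dotProduct_smul, smul_eq_mul, hRy, h2] at h0
  rw [dotProduct_comm x w, dotProduct_comm y w] at h0
  have : 0 ≤ c * (c * (w ⬝ᵥ y) - w ⬝ᵥ x) := by linarith
  have := nonneg_of_mul_nonneg_right this hc
  linarith

/-- Transfer of the spectral bounds between `𝒜` and the mean-based matrix
`I_Q ⊗ A` to their inverses. -/
theorem stmt_3
    (Q Nu M : ℕ) (hQ : 0 < Q) (hNu : 0 < Nu)
    (A A0 : Matrix (Fin Nu) (Fin Nu) ℝ)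
    (Am : Fin M → Matrix (Fin Nu) (Fin Nu) ℝ)
    (G : Fin M → Matrix (Fin Q) (Fin Q) ℝ)
    (hAsymm : A.IsSymm) (hA0symm : A0.IsSymm)
    (hAmsymm : ∀ m, (Am m).IsSymm) (hGsymm : ∀ m, (G m).IsSymm)
    (𝒜 : Matrix (Fin Q × Fin Nu) (Fin Q × Fin Nu) ℝ)
    (h𝒜 : 𝒜 = (1 : Matrix (Fin Q) (Fin Q) ℝ) ⊗ₖ A0 + ∑ m, (G m) ⊗ₖ (Am m))
    (hApd : ∀ v : Fin Nu → ℝ, v ≠ 0 → 0 < v ⬝ᵥ A *ᵥ v)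
    (σ : ℝ) (hσ : 0 ≤ σ)
    (χm : Fin M → ℝ) (hχm : ∀ m, 0 ≤ χm m)
    (χ : ℝ) (hχ : χ = ∑ m, χm m)
    (νlo νhi : ℝ) (hνlo : 0 < νlo) (hνlohi : νlo ≤ νhi)
    (hA0lo : ∀ v : Fin Nu → ℝ, νlo * (v ⬝ᵥ A *ᵥ v) ≤ v ⬝ᵥ A0 *ᵥ v)
    (hA0hi : ∀ v : Fin Nu → ℝ, v ⬝ᵥ A0 *ᵥ v ≤ νhi * (v ⬝ᵥ A *ᵥ v))
    (hAmb : ∀ m, ∀ v : Fin Nu → ℝ, |v ⬝ᵥ (Am m) *ᵥ v| ≤ σ * χm m * (v ⬝ᵥ A *ᵥ v))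
    (hGb : ∀ m, ∀ a : Fin Q → ℝ, |a ⬝ᵥ (G m) *ᵥ a| ≤ Real.sqrt 3 * (a ⬝ᵥ a))
    (hKL : Real.sqrt 3 * σ * χ < νlo) :
    IsUnit 𝒜 ∧
    ∀ w : Fin Q × Fin Nu → ℝ, w ≠ 0 →
      (νlo - Real.sqrt 3 * σ * χ) * (w ⬝ᵥ 𝒜⁻¹ *ᵥ w) ≤
          w ⬝ᵥ ((1 : Matrix (Fin Q) (Fin Q) ℝ) ⊗ₖ A)⁻¹ *ᵥ w ∧
      w ⬝ᵥ ((1 : Matrix (Fin Q) (Fin Q) ℝ) ⊗ₖ A)⁻¹ *ᵥ w ≤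
          (νhi + Real.sqrt 3 * σ * χ) * (w ⬝ᵥ 𝒜⁻¹ *ᵥ w) := by
  have hB0 : A.PosDef := by
    refine Matrix.PosDef.of_dotProduct_mulVec_pos ?_ (fun v hv => by simpa using hApd v hv)
    simpa [Matrix.IsHermitian, Matrix.conjTranspose_eq_transpose_of_trivial] using hAsymm.eq
  have hB : ((1 : Matrix (Fin Q) (Fin Q) ℝ) ⊗ₖ A).PosDef := PosDef.one.kronecker hB0
  have hs3 : 0 ≤ Real.sqrt 3 := Real.sqrt_nonneg 3
  have hχ0 : 0 ≤ χ := hχ ▸ Finset.sum_nonneg fun m _ => hχm m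
  have hlo : ∀ x : Fin Q × Fin Nu → ℝ, νlo * (x ⬝ᵥ ((1 : Matrix (Fin Q) (Fin Q) ℝ) ⊗ₖ A) *ᵥ x) ≤
      x ⬝ᵥ ((1 : Matrix (Fin Q) (Fin Q) ℝ) ⊗ₖ A0) *ᵥ x := fun x => by
    have h1 : (A0 + (-νlo) • A).PosSemidef := by
      refine psd_of_quad _ (hA0symm.add (hAsymm.smul _)) fun v => ?_
      have := hA0lo v
      simp only [add_mulVec, smul_mulVec, dotProduct_add, dotProduct_smul, smul_eq_mul]
      linarith
    have e := quad_of_psd _ ((PosSemidef.one (n := Fin Q) (R := ℝ)).kronecker h1) x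
    simp only [kronecker_add, kronecker_smul, add_mulVec, smul_mulVec, dotProduct_add,
      dotProduct_smul, smul_eq_mul] at e
    linarith
  have hhi : ∀ x : Fin Q × Fin Nu → ℝ, x ⬝ᵥ ((1 : Matrix (Fin Q) (Fin Q) ℝ) ⊗ₖ A0) *ᵥ x ≤
      νhi * (x ⬝ᵥ ((1 : Matrix (Fin Q) (Fin Q) ℝ) ⊗ₖ A) *ᵥ x) := fun x => by
    have h1 : (νhi • A + (-1 : ℝ) • A0).PosSemidef := by
      refine psd_of_quad _ ((hAsymm.smul _).add (hA0symm.smul _)) fun v => ?_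
      have := hA0hi v
      simp only [add_mulVec, smul_mulVec, dotProduct_add, dotProduct_smul, smul_eq_mul]
      linarith
    have e := quad_of_psd _ ((PosSemidef.one (n := Fin Q) (R := ℝ)).kronecker h1) x
    simp only [kronecker_add, kronecker_smul, add_mulVec, smul_mulVec, dotProduct_add,
      dotProduct_smul, smul_eq_mul] at e
    linarith
  have hsum : ∀ x : Fin Q × Fin Nu → ℝ, |x ⬝ᵥ (∑ m, (G m) ⊗ₖ (Am m)) *ᵥ x| ≤
      Real.sqrt 3 * σ * χ * (x ⬝ᵥ ((1 : Matrix (Fin Q) (Fin Q) ℝ) ⊗ₖ A) *ᵥ x) := fun x => by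
    rw [sum_mulVec, dotProduct_sum, hχ, Finset.mul_sum, Finset.sum_mul]
    refine (Finset.abs_sum_le_sum_abs _ _).trans (Finset.sum_le_sum fun m _ => ?_)
    have := kron_bound (G m) A (Am m) _ _ (hGsymm m) hAsymm (hAmsymm m) (hGb m) (hAmb m) x
    rwa [← mul_assoc] at this
  have hL : ∀ x : Fin Q × Fin Nu → ℝ, (νlo - Real.sqrt 3 * σ * χ) *
      (x ⬝ᵥ ((1 : Matrix (Fin Q) (Fin Q) ℝ) ⊗ₖ A) *ᵥ x) ≤ x ⬝ᵥ 𝒜 *ᵥ x := fun x => by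
    rw [h𝒜, add_mulVec, dotProduct_add]
    linarith [hlo x, (abs_le.1 (hsum x)).1]
  have hU : ∀ x : Fin Q × Fin Nu → ℝ, x ⬝ᵥ 𝒜 *ᵥ x ≤ (νhi + Real.sqrt 3 * σ * χ) *
      (x ⬝ᵥ ((1 : Matrix (Fin Q) (Fin Q) ℝ) ⊗ₖ A) *ᵥ x) := fun x => by
    rw [h𝒜, add_mulVec, dotProduct_add]
    linarith [hhi x, (abs_le.1 (hsum x)).2]
  have hd : 0 < νlo - Real.sqrt 3 * σ * χ := by linarith
  have hsymm : 𝒜ᵀ = 𝒜 := by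
    rw [h𝒜, transpose_add, transpose_sum, ← kroneckerMap_transpose, transpose_one, hA0symm.eq]
    congr 1
    refine Finset.sum_congr rfl fun m _ => ?_
    rw [← kroneckerMap_transpose, (hGsymm m).eq, (hAmsymm m).eq]
  have hPD : 𝒜.PosDef := by
    refine Matrix.PosDef.of_dotProduct_mulVec_pos ?_ (fun v hv => ?_)
    · simpa [Matrix.IsHermitian, Matrix.conjTranspose_eq_transpose_of_trivial] using hsymm
    · have h1 : 0 < v ⬝ᵥ ((1 : Matrix (Fin Q) (Fin Q) ℝ) ⊗ₖ A) *ᵥ v := by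
        simpa using hB.dotProduct_mulVec_pos hv
      have := (mul_pos hd h1).trans_le (hL v)
      simpa using this
  refine ⟨hPD.isUnit, fun w _ => ⟨?_, ?_⟩⟩
  · have := inv_bound 𝒜 _ hPD.isUnit hB (νlo - Real.sqrt 3 * σ * χ)⁻¹ (inv_pos.2 hd)
      (fun x => by rw [le_inv_mul_iff₀ hd]; exact hL x) w
    rwa [le_inv_mul_iff₀ hd] at this
  · have h3 : 0 ≤ Real.sqrt 3 * σ * χ := by positivity
    exact inv_bound _ 𝒜 hB.isUnit hPD _ (by linarith) hU w
end

section
/- Let A and Ã be real symmetric positive definite Nu×Nu matrices and δ, Δ > 0 with δ · v^T Ã v ≤ v^T A v ≤ Δ · v^T Ã v for all v ∈ ℝ^{Nu}. Let B be a real Np×Nu matrix, D_p a real symmetric positive definite Np×Np matrix, and θ, γ, Θ > 0 with θ²·γ² · q^T D_p q ≤ q^T B A^{-1} B^T q ≤ Θ² · q^T D_p q for all q ∈ ℝ^{Np}. Then for all p ∈ ℝ^{Q·Np}, δ·θ²·γ² · p^T (I_Q ⊗ D_p) p ≤ p^T (I_Q ⊗ B)(I_Q ⊗ Ã)^{-1}(I_Q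 ⊗ B)^T p ≤ Δ·Θ² · p^T (I_Q ⊗ D_p) p. (Eigenvalue bounds for the preconditioned approximate stochastic Galerkin finite element Schur complement.) -/
open Matrix
open scoped Kronecker

lemma aux_inv {n : ℕ} (X Y : Matrix (Fin n) (Fin n) ℝ) (hX : IsUnit X.det) (hY : IsUnit Y.det)
    (hYs : Y.IsSymm) (hYp : ∀ v : Fin n → ℝ, 0 ≤ v ⬝ᵥ Y *ᵥ v) (c : ℝ) (hc : 0 ≤ c)
    (h : ∀ v : Fin n → ℝ, c * (v ⬝ᵥ Y *ᵥ v) ≤ v ⬝ᵥ X *ᵥ v) (w : Fin n → ℝ) :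
    c * (w ⬝ᵥ X⁻¹ *ᵥ w) ≤ w ⬝ᵥ Y⁻¹ *ᵥ w := by
  obtain ⟨x, hx⟩ : ∃ x, x = X⁻¹ *ᵥ w := ⟨_, rfl⟩
  obtain ⟨y, hy⟩ : ∃ y, y = Y⁻¹ *ᵥ w := ⟨_, rfl⟩
  have hXx : X *ᵥ x = w := by rw [hx, mulVec_mulVec, mul_nonsing_inv _ hX, one_mulVec]
  have hYy : Y *ᵥ y = w := by rw [hy, mulVec_mulVec, mul_nonsing_inv _ hY, one_mulVec]
  have hyx : y ⬝ᵥ Y *ᵥ x = w ⬝ᵥ x := by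
    rw [dotProduct_mulVec, ← mulVec_transpose, hYs.eq, hYy]
  have h0 := hYp (y - c • x)
  have h1 := h x
  rw [hXx] at h1
  rw [← hx, ← hy]
  simp only [mulVec_sub, mulVec_smul, hYy, dotProduct_sub, sub_dotProduct, smul_dotProduct,
    dotProduct_smul, smul_eq_mul, hyx] at h0
  rw [dotProduct_comm y w] at h0
  rw [dotProduct_comm x w] at h0 h1
  nlinarith [mul_le_mul_of_nonneg_left h1 hc]

lemma aux_unit {n : ℕ} (X : Matrix (Fin n) (Fin n) ℝ) (hs : X.IsSymm)
    (hp : ∀ v : Fin n → ℝ, v ≠ 0 → 0 < v ⬝ᵥ X *ᵥ v) : IsUnit X.det := by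
  have : X.PosDef := PosDef.of_dotProduct_mulVec_pos
    (by rw [IsHermitian, conjTranspose_eq_transpose_of_trivial]; exact hs)
    (fun {v} hv => by simpa using hp v hv)
  exact (isUnit_iff_isUnit_det _).1 this.isUnit

lemma aux_kron {Q n : ℕ} (M : Matrix (Fin n) (Fin n) ℝ) (p : Fin Q × Fin n → ℝ) :
    p ⬝ᵥ ((1 : Matrix (Fin Q) (Fin Q) ℝ) ⊗ₖ M) *ᵥ p =
      ∑ i, (fun j => p (i, j)) ⬝ᵥ M *ᵥ (fun j => p (i, j)) := by
  simp [dotProduct, mulVec, Fintype.sum_prod_type, kroneckerMap_apply, one_apply, ite_mul]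

/-- Eigenvalue bounds for the preconditioned approximate SGFE Schur complement. -/
theorem stmt_5
    (Q Nu Np : ℕ) (hQ : 0 < Q) (hNu : 0 < Nu) (hNp : 0 < Np)
    (A Atil : Matrix (Fin Nu) (Fin Nu) ℝ)
    (hAsymm : A.IsSymm) (hAtilsymm : Atil.IsSymm)
    (hApd : ∀ v : Fin Nu → ℝ, v ≠ 0 → 0 < v ⬝ᵥ A *ᵥ v)
    (hAtilpd : ∀ v : Fin Nu → ℝ, v ≠ 0 → 0 < v ⬝ᵥ Atil *ᵥ v)
    (δ Δ : ℝ) (hδ : 0 < δ) (hΔ : 0 < Δ)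
    (hlo : ∀ v : Fin Nu → ℝ, δ * (v ⬝ᵥ Atil *ᵥ v) ≤ v ⬝ᵥ A *ᵥ v)
    (hhi : ∀ v : Fin Nu → ℝ, v ⬝ᵥ A *ᵥ v ≤ Δ * (v ⬝ᵥ Atil *ᵥ v))
    (B : Matrix (Fin Np) (Fin Nu) ℝ)
    (Dp : Matrix (Fin Np) (Fin Np) ℝ) (hDpsymm : Dp.IsSymm)
    (hDppd : ∀ q : Fin Np → ℝ, q ≠ 0 → 0 < q ⬝ᵥ Dp *ᵥ q)
    (θ γ Θ : ℝ) (hθ : 0 < θ) (hγ : 0 < γ) (hΘ : 0 < Θ)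
    (hSlo : ∀ q : Fin Np → ℝ,
      θ ^ 2 * γ ^ 2 * (q ⬝ᵥ Dp *ᵥ q) ≤ q ⬝ᵥ (B * A⁻¹ * Bᵀ) *ᵥ q)
    (hShi : ∀ q : Fin Np → ℝ,
      q ⬝ᵥ (B * A⁻¹ * Bᵀ) *ᵥ q ≤ Θ ^ 2 * (q ⬝ᵥ Dp *ᵥ q)) :
    ∀ p : Fin Q × Fin Np → ℝ,
      δ * θ ^ 2 * γ ^ 2 * (p ⬝ᵥ ((1 : Matrix (Fin Q) (Fin Q) ℝ) ⊗ₖ Dp) *ᵥ p) ≤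
        p ⬝ᵥ (((1 : Matrix (Fin Q) (Fin Q) ℝ) ⊗ₖ B) *
            ((1 : Matrix (Fin Q) (Fin Q) ℝ) ⊗ₖ Atil)⁻¹ *
            ((1 : Matrix (Fin Q) (Fin Q) ℝ) ⊗ₖ B)ᵀ) *ᵥ p ∧
      p ⬝ᵥ (((1 : Matrix (Fin Q) (Fin Q) ℝ) ⊗ₖ B) *
            ((1 : Matrix (Fin Q) (Fin Q) ℝ) ⊗ₖ Atil)⁻¹ *
            ((1 : Matrix (Fin Q) (Fin Q) ℝ) ⊗ₖ B)ᵀ) *ᵥ p ≤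
        Δ * Θ ^ 2 * (p ⬝ᵥ ((1 : Matrix (Fin Q) (Fin Q) ℝ) ⊗ₖ Dp) *ᵥ p) := by
  have hAu := aux_unit A hAsymm hApd
  have hTu := aux_unit Atil hAtilsymm hAtilpd
  have nn : ∀ X : Matrix (Fin Nu) (Fin Nu) ℝ, (∀ v : Fin Nu → ℝ, v ≠ 0 → 0 < v ⬝ᵥ X *ᵥ v) →
      ∀ v : Fin Nu → ℝ, 0 ≤ v ⬝ᵥ X *ᵥ v := by
    intro X hX v
    by_cases hv : v = 0
    · simp [hv]
    · exact (hX v hv).le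
  have k1 := aux_inv A Atil hAu hTu hAtilsymm (nn _ hAtilpd) δ hδ.le hlo
  have k2 := aux_inv Atil A hTu hAu hAsymm (nn _ hApd) Δ⁻¹ (inv_nonneg.2 hΔ.le)
    (fun v => by rw [inv_mul_le_iff₀ hΔ]; exact hhi v)
  have conv : ∀ (X : Matrix (Fin Nu) (Fin Nu) ℝ) (q : Fin Np → ℝ),
      q ⬝ᵥ (B * X * Bᵀ) *ᵥ q = (Bᵀ *ᵥ q) ⬝ᵥ X *ᵥ (Bᵀ *ᵥ q) := by
    intro X q
    rw [← mulVec_mulVec, ← mulVec_mulVec, dotProduct_mulVec, ← mulVec_transpose]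
  intro p
  have hk : ((1 : Matrix (Fin Q) (Fin Q) ℝ) ⊗ₖ B) * ((1 : Matrix (Fin Q) (Fin Q) ℝ) ⊗ₖ Atil)⁻¹ *
      ((1 : Matrix (Fin Q) (Fin Q) ℝ) ⊗ₖ B)ᵀ =
      (1 : Matrix (Fin Q) (Fin Q) ℝ) ⊗ₖ (B * Atil⁻¹ * Bᵀ) := by
    rw [inv_kronecker, ← kroneckerMap_transpose, ← mul_kronecker_mul, ← mul_kronecker_mul]
    simp
  rw [hk, aux_kron, aux_kron, Finset.mul_sum, Finset.mul_sum]
  constructor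
  · refine Finset.sum_le_sum fun i _ => ?_
    generalize (fun j => p (i, j)) = q
    have h1 := hSlo q
    have h2 := k1 (Bᵀ *ᵥ q)
    rw [← conv, ← conv] at h2
    nlinarith [mul_le_mul_of_nonneg_left h1 hδ.le]
  · refine Finset.sum_le_sum fun i _ => ?_
    generalize (fun j => p (i, j)) = q
    have h1 := hShi q
    have h2 := k2 (Bᵀ *ᵥ q)
    rw [← conv, ← conv, inv_mul_le_iff₀ hΔ] at h2
    nlinarith [mul_le_mul_of_nonneg_left h1 hΔ.le]
end
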